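/- arXiv:1507.01215 — 2 statements merged into one kernel-verified Lean document; each statement's English description precedes it below -/
import Mathlib

section
/- If a class C of r.e. sets is BC* learnable, then there is a single learner which simultaneously finitely approximately (FinApprox) learns C and BC*-learns C. -/
open Filter

/-- The `e`-th partial recursive function in a fixed acceptable numbering. -/
def phi (e : ℕ) : ℕ →. ℕ := Nat.Partrec.Code.eval (Denumerable.ofNat Nat.Partrec.Code e)

/-- The `e`-th recursively enumerable set, `W_e = dom(φ_e)`. -/
def Wset (e : ℕ) : Set ℕ := (phi e).Dom

/-- `T` is a text for `L`: the natural numbers occurring in `T` are exactly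
the members of `L` (`none` plays the role of the pause symbol `#`). -/
def IsText (T : ℕ → Option ℕ) (L : Set ℕ) : Prop :=
  {x : ℕ | ∃ n, T n = some x} = L

/-- The finite sequence `T[n] = T(0), ..., T(n-1)`. -/
def pref (T : ℕ → Option ℕ) (n : ℕ) : List (Option ℕ) :=
  (List.range n).map T

/-- `M` partially (Part) learns `C`: on every text for every `L ∈ C` there is
exactly one index output infinitely often, and that index is an index of `L`. -/
def PartLearns (M : List (Option ℕ) → ℕ) (C : Set (Set ℕ)) : Prop :=
  ∀ L ∈ C, ∀ T : ℕ → Option ℕ, IsText T L →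
    ∃ e, {n | M (pref T n) = e}.Infinite ∧ Wset e = L ∧
      ∀ d, {n | M (pref T n) = d}.Infinite → d = e

/-- `M` is consistent (Cons): every number occurring in `σ` belongs to `W_{M(σ)}`. -/
def ConsLearner (M : List (Option ℕ) → ℕ) : Prop :=
  ∀ σ : List (Option ℕ), ∀ x : ℕ, some x ∈ σ → x ∈ Wset (M σ)

/-- `M` finitely approximately (FinApprox) learns `C`. -/
def FinApproxLearns (M : List (Option ℕ) → ℕ) (C : Set (Set ℕ)) : Prop :=
  ∀ L ∈ C, ∀ T : ℕ → Option ℕ, IsText T L → ∀ D : Finset ℕ,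
    ∀ᶠ n in atTop, Wset (M (pref T n)) ∩ ↑D = L ∩ ↑D

/-- `M` BC*-learns `C`: almost all hypotheses are finite variants of the target. -/
def BCstarLearns (M : List (Option ℕ) → ℕ) (C : Set (Set ℕ)) : Prop :=
  ∀ L ∈ C, ∀ T : ℕ → Option ℕ, IsText T L →
    ∀ᶠ n in atTop, (symmDiff (Wset (M (pref T n))) L).Finite

/-- `M` BC^k-learns `C`: almost all hypotheses differ from the target in at
most `k` elements. -/
def BCnLearns (k : ℕ) (M : List (Option ℕ) → ℕ) (C : Set (Set ℕ)) : Prop :=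
  ∀ L ∈ C, ∀ T : ℕ → Option ℕ, IsText T L →
    ∀ᶠ m in atTop, (symmDiff (Wset (M (pref T m))) L).Finite ∧
      (symmDiff (Wset (M (pref T m))) L).ncard ≤ k

/-- `M` behaviourally correctly (BC) learns `C`. -/
def BCLearns (M : List (Option ℕ) → ℕ) (C : Set (Set ℕ)) : Prop :=
  ∀ L ∈ C, ∀ T : ℕ → Option ℕ, IsText T L →
    ∀ᶠ n in atTop, Wset (M (pref T n)) = L

/-- `M` explanatorily (Ex) learns `C`. -/
def ExLearns (M : List (Option ℕ) → ℕ) (C : Set (Set ℕ)) : Prop :=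
  ∀ L ∈ C, ∀ T : ℕ → Option ℕ, IsText T L →
    ∃ e n₀, Wset e = L ∧ ∀ n ≥ n₀, M (pref T n) = e

/-- `M` weakly approximately (WeakApprox) learns `C`: for every text there is
an infinite set `W` such that on every finite variant `V` of `W` almost all
hypotheses agree with the target. -/
def WeakApproxLearns (M : List (Option ℕ) → ℕ) (C : Set (Set ℕ)) : Prop :=
  ∀ L ∈ C, ∀ T : ℕ → Option ℕ, IsText T L →
    ∃ W : Set ℕ, W.Infinite ∧ ∀ V : Set ℕ, (symmDiff V W).Finite →
      ∀ᶠ n in atTop, Wset (M (pref T n)) ∩ V = L ∩ V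

/-- `M` approximately (Approx) learns `C`: for every `L ∈ C` there is an
infinite set `W`, good for all texts for `L`. -/
def ApproxLearns (M : List (Option ℕ) → ℕ) (C : Set (Set ℕ)) : Prop :=
  ∀ L ∈ C, ∃ W : Set ℕ, W.Infinite ∧ ∀ T : ℕ → Option ℕ, IsText T L →
    ∀ V : Set ℕ, (symmDiff V W).Finite →
      ∀ᶠ n in atTop, Wset (M (pref T n)) ∩ V = L ∩ V

/-- Conservativeness for partial learners: on each text for every `L ∈ C`, `M`
outputs exactly one index `e` with `L ⊆ W_e`. -/
def ConsvLearner (M : List (Option ℕ) → ℕ) (C : Set (Set ℕ)) : Prop :=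
  ∀ L ∈ C, ∀ T : ℕ → Option ℕ, IsText T L →
    ∃! e, (∃ n, M (pref T n) = e) ∧ L ⊆ Wset e

/-- Confidence: on every infinite sequence, `M` outputs exactly one index
infinitely often. -/
def Confident (M : List (Option ℕ) → ℕ) : Prop :=
  ∀ T : ℕ → Option ℕ, ∃! e, {n | M (pref T n) = e}.Infinite

/-- The sets ever conjectured by `M` (used to express prudence). -/
def Conjectured (M : List (Option ℕ) → ℕ) : Set (Set ℕ) :=
  {S | ∃ σ : List (Option ℕ), S = Wset (M σ)}

/-- Effective s-m-n: a partial recursive function with a parameter yields a computable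
function producing indices of the sections. -/
theorem exists_computable_index {α : Type*} [Primcodable α] {f : α → ℕ →. ℕ} (hf : Partrec₂ f) :
    ∃ g : α → ℕ, Computable g ∧ ∀ a, phi (g a) = f a := by
  have hf' : Nat.Partrec fun n => ((Encodable.decode (α := α) n.unpair.1 : Part α)).bind
      fun a => f a n.unpair.2 := by
    refine Partrec.nat_iff.1 ?_
    refine Partrec.bind (Computable.ofOption
      (Computable.decode.comp (Computable.fst.comp Computable.unpair))) ?_
    exact hf.comp Computable.snd
      (Computable.snd.comp (Computable.unpair.comp Computable.fst))
  obtain ⟨c, hc⟩ := Nat.Partrec.Code.exists_code.1 hf'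
  refine ⟨fun a => Encodable.encode (c.curry (Encodable.encode a)), ?_, fun a => ?_⟩
  · exact Computable.encode.comp
      (Nat.Partrec.Code.primrec₂_curry.to_comp.comp (Computable.const c) Computable.encode)
  · funext x
    simp [phi, Nat.Partrec.Code.eval_curry, hc]

/-- The partial function with index `M σ`, with its domain corrected below the length of `σ` so
that it agrees there with the content of `σ`. -/
def patch (M : List (Option ℕ) → ℕ) (σ : List (Option ℕ)) (x : ℕ) : Part ℕ :=
  bif decide (x < σ.length) then
    (bif decide (σ.idxOf (some x) < σ.length) then Part.some 0 else Part.none)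
  else phi (M σ) x

theorem patch_partrec {M : List (Option ℕ) → ℕ} (hM : Computable M) : Partrec₂ (patch M) := by
  have hlen : Primrec fun p : List (Option ℕ) × ℕ => p.1.length :=
    Primrec.list_length.comp Primrec.fst
  have hidx : Primrec fun p : List (Option ℕ) × ℕ => p.1.idxOf (some p.2) := by
    convert Primrec.list_idxOf.comp
      (Primrec.option_some.comp (Primrec.snd (α := List (Option ℕ)) (β := ℕ))) Primrec.fst using 3
    exact lawful_beq_subsingleton _ _
  refine Partrec.cond (Primrec.nat_lt.decide.comp Primrec.snd hlen).to_comp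
    (Partrec.cond (Primrec.nat_lt.decide.comp hidx hlen).to_comp
      (Computable.const 0).partrec Partrec.none) ?_
  exact Nat.Partrec.Code.eval_part.comp
    ((Computable.ofNat _).comp (hM.comp Computable.fst)) Computable.snd

theorem patch_dom_of_lt {M : List (Option ℕ) → ℕ} {σ : List (Option ℕ)} {x : ℕ}
    (hx : x < σ.length) : (patch M σ x).Dom ↔ some x ∈ σ := by
  by_cases hm : some x ∈ σ <;> simp [patch, hx, List.idxOf_lt_length_iff, hm]

theorem patch_dom_of_le {M : List (Option ℕ) → ℕ} {σ : List (Option ℕ)} {x : ℕ}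
    (hx : σ.length ≤ x) : (patch M σ x).Dom ↔ x ∈ Wset (M σ) := by
  simp [patch, hx.not_gt, Wset, PFun.mem_dom, Part.dom_iff_mem]

/-- The content of a prefix of a text for `L` eventually decides membership of `x` in `L`. -/
theorem IsText.eventually_mem_pref_iff {T : ℕ → Option ℕ} {L : Set ℕ} (hT : IsText T L) (x : ℕ) :
    ∀ᶠ n in atTop, some x ∈ pref T n ↔ x ∈ L := by
  subst hT
  by_cases hx : ∃ k, T k = some x
  · obtain ⟨k, hk⟩ := hx
    filter_upwards [eventually_gt_atTop k] with n hn
    simp only [pref, List.mem_map, List.mem_range]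
    exact ⟨fun ⟨m, _, hm⟩ => ⟨m, hm⟩, fun _ => ⟨k, hn, hk⟩⟩
  · refine Eventually.of_forall fun n => ?_
    simp only [pref, List.mem_map, List.mem_range, Set.mem_ofPred_eq, hx, iff_false]
    exact fun ⟨m, _, hm⟩ => hx ⟨m, hm⟩

/-- If `C` is BC* learnable then `C` is FinApproxBC* learnable. -/
theorem stmt13 (C : Set (Set ℕ)) (hC : ∀ L ∈ C, ∃ e, Wset e = L)
    (h : ∃ M : List (Option ℕ) → ℕ, Computable M ∧ BCstarLearns M C) :
    ∃ N : List (Option ℕ) → ℕ, Computable N ∧ FinApproxLearns N C ∧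
      BCstarLearns N C := by
  obtain ⟨M, hM, hMC⟩ := h
  obtain ⟨N, hN, hNM⟩ := exists_computable_index (patch_partrec hM)
  have hmem (σ : List (Option ℕ)) (x : ℕ) : x ∈ Wset (N σ) ↔ (patch M σ x).Dom := by
    rw [Wset, hNM]; rfl
  refine ⟨N, hN, fun L hL T hT D => ?_, fun L hL T hT => ?_⟩
  · have hD : ∀ᶠ n in atTop, ∀ x ∈ D, x < n ∧ (some x ∈ pref T n ↔ x ∈ L) :=
      (eventually_all_finset D).2 fun x _ =>
        (eventually_gt_atTop x).and (hT.eventually_mem_pref_iff x)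
    filter_upwards [hD] with n hn
    ext x
    simp only [Set.mem_inter_iff, Finset.mem_coe, and_congr_left_iff]
    intro hx
    rw [hmem, patch_dom_of_lt (by simpa [pref] using (hn x hx).1), (hn x hx).2]
  · filter_upwards [hMC L hL T hT] with n hn
    refine (hn.union (Set.finite_Iio (pref T n).length)).subset fun x hx => ?_
    by_cases hlt : x < (pref T n).length
    · exact Or.inr hlt
    · left
      rw [Set.mem_symmDiff] at hx ⊢
      rwa [hmem, patch_dom_of_le (not_lt.1 hlt)] at hx
end

section
/- Let C be the class of all sets A ⊆ ℕ such that A = ℕ, or A contains all even numbers and only finitely many odd numbers, or A contains all odd numbers and only finitely many even numbers. Then: (a) there is a learner which is consistent (Cons) and weakly approximately (WeakApprox) learns C; (b) there is a learner which consistently partially (ConsPart) learns C; but (c) there is no single learner which simultaneously weakly approximately (WeakApprox) learns C and partially (Part) learns C. -/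
open Filter

/-- The class of all sets which equal ℕ, or contain all even numbers and only
finitely many odd numbers, or contain all odd numbers and only finitely many
even numbers. -/
def evenOddClass : Set (Set ℕ) :=
  {A | A = Set.univ ∨
    ((∀ x, Even x → x ∈ A) ∧ {x | Odd x ∧ x ∈ A}.Finite) ∨
    ((∀ x, Odd x → x ∈ A) ∧ {x | Even x ∧ x ∈ A}.Finite)}

/-! ### Indices of uniformly decidable families -/

theorem primrecRel_mem_list {α : Type*} [Primcodable α] :
    PrimrecRel fun (a : α) (l : List α) => a ∈ l :=
  (PrimrecRel.exists_mem_list (R := fun a b : α => a = b) Primrec.eq).swap.of_eq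
    fun a l => by simp

/-- A uniformly primitive recursive family of sets has a computable family of indices. -/
theorem exists_computable_index_s15 {α : Type*} [Primcodable α] {R : α → ℕ → Prop}
    (hR : PrimrecRel R) :
    ∃ idx : α → ℕ, Computable idx ∧ ∀ a, Wset (idx a) = {x | R a x} := by
  have hre : REPred fun z : α × ℕ => R z.1 z.2 := (PrimrecPred.computablePred hR).to_re
  obtain ⟨c, hc⟩ := Nat.Partrec.Code.exists_code.1 hre
  refine ⟨fun a => Encodable.encode (c.curry (Encodable.encode a)), ?_, fun a => ?_⟩
  · exact Computable.encode.comp (Nat.Partrec.Code.primrec₂_curry.to_comp.comp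
      (Computable.const c) Computable.encode)
  · ext x
    simp only [Wset, phi, Denumerable.ofNat_encode, PFun.mem_dom, Set.mem_ofPred_eq,
      Nat.Partrec.Code.eval_curry, hc]
    simp [Part.mem_assert_iff]

/-! ### Prefixes of texts -/

theorem mem_pref {T : ℕ → Option ℕ} {n : ℕ} {o : Option ℕ} :
    o ∈ pref T n ↔ ∃ m < n, T m = o := by
  simp [pref]

theorem pref_succ (T : ℕ → Option ℕ) (n : ℕ) : pref T (n + 1) = pref T n ++ [T n] := by
  simp [pref, List.range_succ]

theorem length_pref (T : ℕ → Option ℕ) (n : ℕ) : (pref T n).length = n := by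
  simp [pref]

theorem eventually_mem_pref {T : ℕ → Option ℕ} {o : Option ℕ} (h : ∃ m, T m = o) :
    ∀ᶠ n in atTop, o ∈ pref T n := by
  obtain ⟨m, hm⟩ := h
  filter_upwards [eventually_gt_atTop m] with n hn
  exact mem_pref.2 ⟨m, hn, hm⟩

theorem IsText.exists_iff {T : ℕ → Option ℕ} {L : Set ℕ} (h : IsText T L) (x : ℕ) :
    (∃ n, T n = some x) ↔ x ∈ L := by
  rw [← h]; rfl

theorem IsText.mem_of_mem_pref {T : ℕ → Option ℕ} {L : Set ℕ} (h : IsText T L) {x n : ℕ}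
    (hx : some x ∈ pref T n) : x ∈ L := by
  obtain ⟨m, -, hm⟩ := mem_pref.1 hx
  exact (h.exists_iff x).1 ⟨m, hm⟩

theorem IsText.eventually_mem {T : ℕ → Option ℕ} {L : Set ℕ} (h : IsText T L) {x : ℕ}
    (hx : x ∈ L) : ∀ᶠ n in atTop, some x ∈ pref T n :=
  eventually_mem_pref ((h.exists_iff x).2 hx)

/-- A proper subset of `ℕ` in the class omits some number `m`; it then contains every number
of the parity opposite to `m` and only finitely many of the parity of `m`. -/
theorem evenOddClass_of_notMem {L : Set ℕ} (hL : L ∈ evenOddClass) {m : ℕ} (hm : m ∉ L) :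
    (∀ x, x % 2 ≠ m % 2 → x ∈ L) ∧ {x | x % 2 = m % 2 ∧ x ∈ L}.Finite := by
  rcases hL with rfl | ⟨h, hf⟩ | ⟨h, hf⟩
  · simp at hm
  · have hm1 : m % 2 = 1 := by
      by_contra hne
      exact hm (h m (Nat.even_iff.2 (by omega)))
    refine ⟨fun x hx => h x (Nat.even_iff.2 (by omega)), ?_⟩
    simpa [hm1, Nat.odd_iff] using hf
  · have hm0 : m % 2 = 0 := by
      by_contra hne
      exact hm (h m (Nat.odd_iff.2 (by omega)))
    refine ⟨fun x hx => h x (Nat.odd_iff.2 (by omega)), ?_⟩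
    simpa [hm0, Nat.even_iff] using hf

theorem parity_union_mem_evenOddClass {p : ℕ} (hp : p < 2) {F : Set ℕ} (hF : F.Finite) :
    {x | x % 2 = p ∨ x ∈ F} ∈ evenOddClass := by
  have key : ∀ q, q ≠ p → {x | x % 2 = q ∧ (x % 2 = p ∨ x ∈ F)}.Finite := fun q hq =>
    hF.subset fun x hx => hx.2.resolve_left fun h => hq (hx.1.symm.trans h)
  obtain rfl | rfl : p = 0 ∨ p = 1 := by omega
  · exact Or.inr (Or.inl ⟨fun x hx => Or.inl (Nat.even_iff.1 hx), by
      simpa [Nat.odd_iff] using key 1 (by omega)⟩)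
  · exact Or.inr (Or.inr ⟨fun x hx => Or.inl (Nat.odd_iff.1 hx), by
      simpa [Nat.even_iff] using key 0 (by omega)⟩)

/-! ### Consistent weakly approximate learning -/

/-- `x` is conjectured after seeing `σ` unless `x` is missing from `σ` while all numbers
`≤ x + 1` of the other parity have been seen. -/
def WeakConj (σ : List (Option ℕ)) (x : ℕ) : Prop :=
  some x ∈ σ ∨ ∃ y < x + 2, y % 2 ≠ x % 2 ∧ some y ∉ σ

theorem primrecRel_weakConj : PrimrecRel WeakConj := by
  have hinner : PrimrecRel fun (y : ℕ) (z : List (Option ℕ) × ℕ) =>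
      y % 2 ≠ z.2 % 2 ∧ some y ∉ z.1 := by
    refine PrimrecPred.and (PrimrecPred.not (Primrec.eq.comp ?_ ?_))
      (PrimrecPred.not (primrecRel_mem_list.comp ?_ ?_))
    · exact Primrec.nat_mod.comp Primrec.fst (Primrec.const 2)
    · exact Primrec.nat_mod.comp (Primrec.snd.comp Primrec.snd) (Primrec.const 2)
    · exact Primrec.option_some.comp Primrec.fst
    · exact Primrec.fst.comp Primrec.snd
  have hex : PrimrecPred fun z : List (Option ℕ) × ℕ =>
      ∃ y < z.2 + 2, y % 2 ≠ z.2 % 2 ∧ some y ∉ z.1 :=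
    (hinner.exists_mem_list.comp (Primrec.list_range.comp
      (Primrec.nat_add.comp Primrec.snd (Primrec.const 2))) Primrec.id).of_eq (by simp)
  exact PrimrecPred.or
    (primrecRel_mem_list.comp (Primrec.option_some.comp Primrec.snd) Primrec.fst) hex

theorem eventually_weakConj_iff {L : Set ℕ} (hL : L ∈ evenOddClass) {T : ℕ → Option ℕ}
    (hT : IsText T L) (x : ℕ) : ∀ᶠ n in atTop, (WeakConj (pref T n) x ↔ x ∈ L) := by
  by_cases hx : x ∈ L
  · filter_upwards [hT.eventually_mem hx] with n hn
    exact iff_of_true (Or.inl hn) hx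
  · have hall : ∀ᶠ n in atTop, ∀ y ∈ Set.Iio (x + 2), y % 2 ≠ x % 2 → some y ∈ pref T n := by
      refine (eventually_all_finite (Set.finite_Iio _)).2 fun y _ => ?_
      by_cases hy : y % 2 = x % 2
      · exact Eventually.of_forall fun n h => absurd hy h
      · exact (hT.eventually_mem ((evenOddClass_of_notMem hL hx).1 y hy)).mono fun n h _ => h
    filter_upwards [hall] with n hn
    refine iff_of_false ?_ hx
    rintro (h | ⟨y, hy, hne, hmem⟩)
    · exact hx (hT.mem_of_mem_pref h)
    · exact hmem (hn y hy hne)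

/-- Of `2 * k` and `2 * k + 1`, whichever appears first is conjectured throughout. -/
theorem exists_forall_weakConj {T : ℕ → Option ℕ} (k : ℕ) :
    ∃ x ≥ k, ∀ n, WeakConj (pref T n) x := by
  by_contra! h
  obtain ⟨a, ha⟩ := h (2 * k) (by omega)
  obtain ⟨b, hb⟩ := h (2 * k + 1) (by omega)
  simp only [WeakConj, not_or, not_exists, not_and, not_not] at ha hb
  have ha' := ha.2 (2 * k + 1) (by omega) (by omega)
  have hb' := hb.2 (2 * k) (by omega) (by omega)
  obtain ⟨i, hi, hTi⟩ := mem_pref.1 ha'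
  obtain ⟨j, hj, hTj⟩ := mem_pref.1 hb'
  have hbi : b ≤ i := by
    by_contra hlt
    exact hb.1 (mem_pref.2 ⟨i, by omega, hTi⟩)
  have haj : a ≤ j := by
    by_contra hlt
    exact ha.1 (mem_pref.2 ⟨j, by omega, hTj⟩)
  omega

theorem exists_infinite_weakConj {L : Set ℕ} (hL : L ∈ evenOddClass) {T : ℕ → Option ℕ}
    (hT : IsText T L) :
    ∃ W : Set ℕ, W.Infinite ∧ ∀ x ∈ W, ∀ n, (WeakConj (pref T n) x ↔ x ∈ L) := by
  by_cases hu : L = Set.univ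
  · refine ⟨{x | ∀ n, WeakConj (pref T n) x}, ?_, fun x hx n => by simp [hu, hx n]⟩
    refine Set.infinite_of_forall_exists_gt fun k => ?_
    obtain ⟨x, hx, h⟩ := exists_forall_weakConj (T := T) (k + 1)
    exact ⟨x, h, by omega⟩
  · obtain ⟨m, hm⟩ := (Set.ne_univ_iff_exists_notMem L).1 hu
    refine ⟨{x | x % 2 ≠ m % 2 ∧ m ≤ x}, ?_, fun x hx n => ?_⟩
    · refine Set.infinite_of_forall_exists_gt fun k => ⟨2 * (k + m) + 1 + m, ?_, by omega⟩
      exact ⟨by omega, by omega⟩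
    · refine iff_of_true (Or.inr ⟨m, ?_, Ne.symm hx.1, fun h => hm (hT.mem_of_mem_pref h)⟩)
        ((evenOddClass_of_notMem hL hm).1 x hx.1)
      have := hx.2
      omega

theorem exists_cons_weakApprox_learner :
    ∃ M : List (Option ℕ) → ℕ, Computable M ∧ ConsLearner M ∧
      WeakApproxLearns M evenOddClass := by
  obtain ⟨M, hM, hW⟩ := exists_computable_index_s15 primrecRel_weakConj
  refine ⟨M, hM, fun σ x hx => ?_, fun L hL T hT => ?_⟩
  · rw [hW]
    exact Or.inl hx
  · obtain ⟨W, hinf, hgood⟩ := exists_infinite_weakConj hL hT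
    refine ⟨W, hinf, fun V hV => ?_⟩
    have hpt : ∀ᶠ n in atTop, ∀ x ∈ symmDiff V W, (WeakConj (pref T n) x ↔ x ∈ L) :=
      (eventually_all_finite hV).2 fun x _ => eventually_weakConj_iff hL hT x
    filter_upwards [hpt] with n hn
    ext x
    simp only [hW, Set.mem_inter_iff, Set.mem_ofPred_eq, and_congr_left_iff]
    intro hxV
    by_cases hxW : x ∈ W
    · exact hgood x hxW n
    · exact hn x (Or.inl ⟨hxV, hxW⟩)

/-! ### Consistent partial learning -/

/-- The least number below the length of `σ` that is missing from `σ`, or the length of `σ`. -/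
def firstMissing (σ : List (Option ℕ)) : ℕ :=
  (List.range σ.length).findIdx fun k => decide (some k ∉ σ)

theorem primrec_firstMissing : Primrec firstMissing := by
  refine Primrec.list_findIdx (Primrec.list_range.comp Primrec.list_length) ?_
  refine PrimrecPred.decide (p := fun z : List (Option ℕ) × ℕ => some z.2 ∉ z.1) ?_
  exact PrimrecPred.not
    (primrecRel_mem_list.comp (Primrec.option_some.comp Primrec.snd) Primrec.fst)

theorem firstMissing_notMem {σ : List (Option ℕ)} (h : firstMissing σ < σ.length) :
    some (firstMissing σ) ∉ σ := by
  have h' : firstMissing σ < (List.range σ.length).length := by simpa using h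
  have := List.findIdx_getElem (w := h')
  simpa [firstMissing] using this

theorem firstMissing_eq {σ : List (Option ℕ)} {m : ℕ} (hlen : m < σ.length)
    (hm : some m ∉ σ) (hlt : ∀ k < m, some k ∈ σ) : firstMissing σ = m := by
  rw [firstMissing, List.findIdx_eq (by simpa using hlen)]
  simpa [hm] using hlt

/-- The entries of `σ` of parity `p`, without repetitions (a pause counts as even). -/
def seenOfParity (p : ℕ) (σ : List (Option ℕ)) : List (Option ℕ) :=
  σ.foldl (fun l o => if o ∉ l ∧ o.getD 0 % 2 = p then o :: l else l) []

theorem seenOfParity_append_singleton (p : ℕ) (σ : List (Option ℕ)) (o : Option ℕ) :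
    seenOfParity p (σ ++ [o]) =
      if o ∉ seenOfParity p σ ∧ o.getD 0 % 2 = p then o :: seenOfParity p σ
      else seenOfParity p σ := by
  rw [seenOfParity, List.foldl_append]
  rfl

theorem mem_seenOfParity {p : ℕ} {σ : List (Option ℕ)} {o : Option ℕ} :
    o ∈ seenOfParity p σ ↔ o ∈ σ ∧ o.getD 0 % 2 = p := by
  induction σ using List.reverseRecOn with
  | nil => simp [seenOfParity]
  | append_singleton σ a ih =>
    rw [seenOfParity_append_singleton]
    split_ifs with h
    · rw [List.mem_cons, ih, List.mem_append, List.mem_singleton]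
      grind
    · rw [ih, List.mem_append, List.mem_singleton]
      grind

theorem primrec₂_seenOfParity : Primrec₂ seenOfParity := by
  refine Primrec.list_foldl (h := fun (z : ℕ × List (Option ℕ))
    (w : List (Option ℕ) × Option ℕ) =>
      if w.2 ∉ w.1 ∧ w.2.getD 0 % 2 = z.1 then w.2 :: w.1 else w.1)
    Primrec.snd (Primrec.const []) ?_
  have hl : Primrec fun q : (ℕ × List (Option ℕ)) × (List (Option ℕ) × Option ℕ) => q.2.1 :=
    Primrec.fst.comp Primrec.snd
  have ho : Primrec fun q : (ℕ × List (Option ℕ)) × (List (Option ℕ) × Option ℕ) => q.2.2 :=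
    Primrec.snd.comp Primrec.snd
  refine Primrec.ite (PrimrecPred.and (PrimrecPred.not (primrecRel_mem_list.comp ho hl))
    (Primrec.eq.comp ?_ (Primrec.fst.comp Primrec.fst))) (Primrec.list_cons.comp ho hl) hl
  exact Primrec.nat_mod.comp (Primrec.option_getD.comp ho (Primrec.const 0)) (Primrec.const 2)

theorem eventually_seenOfParity_eq {L : Set ℕ} {T : ℕ → Option ℕ} (hT : IsText T L) {p : ℕ}
    (hfin : {x | x % 2 = p ∧ x ∈ L}.Finite) :
    ∃ l, ∀ᶠ n in atTop, seenOfParity p (pref T n) = l := by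
  have hS : (insert none (some '' {x | x % 2 = p ∧ x ∈ L})).Finite := (hfin.image _).insert _
  have hall : ∀ᶠ n in atTop, ∀ o ∈ insert none (some '' {x | x % 2 = p ∧ x ∈ L}),
      (∃ m, T m = o) → o ∈ pref T n := by
    refine (eventually_all_finite hS).2 fun o _ => ?_
    by_cases ho : ∃ m, T m = o
    · exact (eventually_mem_pref ho).mono fun n h _ => h
    · exact Eventually.of_forall fun n h => absurd h ho
  obtain ⟨N, hN⟩ := eventually_atTop.1 hall
  refine ⟨seenOfParity p (pref T N), eventually_atTop.2 ⟨N, fun n hn => ?_⟩⟩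
  induction n, hn using Nat.le_induction with
  | base => rfl
  | succ n hn ih =>
    rw [pref_succ, seenOfParity_append_singleton, if_neg, ih]
    rintro ⟨hnot, hpar⟩
    refine hnot (mem_seenOfParity.2 ⟨hN n hn _ ?_ ⟨n, rfl⟩, hpar⟩)
    cases hTn : T n with
    | none => exact Set.mem_insert _ _
    | some x =>
      refine Set.mem_insert_of_mem _ ⟨x, ⟨by simpa [hTn] using hpar, ?_⟩, rfl⟩
      exact (hT.exists_iff x).1 ⟨n, hTn⟩

/-- The set of all numbers of parity other than `z.1` together with those listed in `z.2`. -/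
def ParityConj (z : ℕ × List (Option ℕ)) (x : ℕ) : Prop :=
  x % 2 ≠ z.1 ∨ some x ∈ z.2

theorem primrecRel_parityConj : PrimrecRel ParityConj := by
  refine PrimrecPred.or (PrimrecPred.not (Primrec.eq.comp
    (Primrec.nat_mod.comp Primrec.snd (Primrec.const 2)) (Primrec.fst.comp Primrec.fst)))
    (primrecRel_mem_list.comp (Primrec.option_some.comp Primrec.snd)
      (Primrec.snd.comp Primrec.fst))

/-- The finite data determining the conjecture made after seeing `σ`. -/
def parityData (σ : List (Option ℕ)) : ℕ × List (Option ℕ) :=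
  (firstMissing σ % 2, seenOfParity (firstMissing σ % 2) σ)

/-- Conjecture `ℕ` (with index `eN`) whenever the first missing number changes, and otherwise
the numbers of parity opposite to it together with the data seen so far. -/
def partLearner (eN : ℕ) (idx : ℕ × List (Option ℕ) → ℕ) (σ : List (Option ℕ)) : ℕ :=
  if firstMissing σ ≠ firstMissing σ.reverse.tail.reverse then eN else idx (parityData σ)

theorem computable_partLearner (eN : ℕ) {idx : ℕ × List (Option ℕ) → ℕ}
    (hidx : Computable idx) : Computable (partLearner eN idx) := by
  have hpar : Primrec fun σ => firstMissing σ % 2 :=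
    Primrec.nat_mod.comp primrec_firstMissing (Primrec.const 2)
  have hdata : Primrec parityData :=
    hpar.pair (primrec₂_seenOfParity.comp hpar Primrec.id)
  have hc : PrimrecPred fun σ : List (Option ℕ) =>
      firstMissing σ ≠ firstMissing σ.reverse.tail.reverse :=
    PrimrecPred.not (Primrec.eq.comp primrec_firstMissing (primrec_firstMissing.comp
      (Primrec.list_reverse.comp (Primrec.list_tail.comp Primrec.list_reverse))))
  refine (Computable.cond hc.decide.to_comp (Computable.const eN)
    (hidx.comp hdata.to_comp)).of_eq fun σ => ?_
  simp [partLearner]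

theorem partLearner_pref_succ (eN : ℕ) (idx : ℕ × List (Option ℕ) → ℕ) (T : ℕ → Option ℕ)
    (n : ℕ) : partLearner eN idx (pref T (n + 1)) =
      if firstMissing (pref T (n + 1)) ≠ firstMissing (pref T n) then eN
      else idx (parityData (pref T (n + 1))) := by
  simp [partLearner, pref_succ]

section PartLearner

variable {eN : ℕ} {idx : ℕ × List (Option ℕ) → ℕ}

theorem partLearner_cons (heN : Wset eN = Set.univ)
    (hidx : ∀ z, Wset (idx z) = {x | ParityConj z x}) : ConsLearner (partLearner eN idx) := by
  intro σ x hx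
  rw [partLearner]
  split_ifs
  · simp [heN]
  · rw [hidx]
    by_cases h : x % 2 = firstMissing σ % 2
    · exact Or.inr (mem_seenOfParity.2 ⟨hx, h⟩)
    · exact Or.inl h

theorem infinite_partLearner_eq_of_univ {T : ℕ → Option ℕ} (hT : IsText T Set.univ) :
    {n | partLearner eN idx (pref T n) = eN}.Infinite := by
  rw [← Nat.frequently_atTop_iff_infinite]
  intro hev
  obtain ⟨N, hN⟩ := eventually_atTop.1 hev
  have hconst : ∀ n ≥ N, firstMissing (pref T n) = firstMissing (pref T N) := by
    intro n hn
    induction n, hn using Nat.le_induction with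
    | base => rfl
    | succ n hn ih =>
      rw [← ih]
      by_contra hne
      exact hN (n + 1) (by omega) ((partLearner_pref_succ eN idx T n).trans (if_pos hne))
  obtain ⟨n, hmem, hn, hlt⟩ := ((hT.eventually_mem (Set.mem_univ (firstMissing (pref T N)))).and
    ((eventually_ge_atTop N).and
      (eventually_gt_atTop (firstMissing (pref T N))))).exists
  rw [← hconst n hn] at hmem hlt
  exact firstMissing_notMem (by rwa [length_pref]) hmem

theorem eq_of_infinite_partLearner_of_univ (heN : Wset eN = Set.univ)
    (hidx : ∀ z, Wset (idx z) = {x | ParityConj z x}) {T : ℕ → Option ℕ}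
    (hT : IsText T Set.univ) {d : ℕ}
    (hd : {n | partLearner eN idx (pref T n) = d}.Infinite) : d = eN := by
  by_contra hne
  obtain ⟨n, hn⟩ := hd.nonempty
  have hdn : d = idx (parityData (pref T n)) := by
    rw [Set.mem_ofPred_eq, partLearner] at hn
    split_ifs at hn
    · exact absurd hn.symm hne
    · exact hn.symm
  set z := parityData (pref T n)
  have hp : z.1 < 2 := Nat.mod_lt _ two_pos
  have hfin : {x | some x ∈ z.2}.Finite :=
    (List.finite_toSet z.2).preimage (Option.some_injective ℕ).injOn
  obtain ⟨B, hB⟩ := hfin.bddAbove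
  have hx : ¬ ParityConj z (2 * (B + 1) + z.1) := by
    rintro (h | h)
    · omega
    · have := hB h
      omega
  obtain ⟨k, hk, hmem⟩ := ((Nat.frequently_atTop_iff_infinite.2 hd).and_eventually
    (hT.eventually_mem (Set.mem_univ (2 * (B + 1) + z.1)))).exists
  have := partLearner_cons heN hidx _ _ hmem
  rw [hk, hdn, hidx] at this
  exact hx this

theorem eventually_partLearner_eq_of_ne_univ (hidx : ∀ z, Wset (idx z) = {x | ParityConj z x})
    {L : Set ℕ} (hL : L ∈ evenOddClass) (hu : L ≠ Set.univ) {T : ℕ → Option ℕ}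
    (hT : IsText T L) :
    ∃ e, Wset e = L ∧ ∀ᶠ n in atTop, partLearner eN idx (pref T n) = e := by
  classical
  have hex : ∃ m, m ∉ L := (Set.ne_univ_iff_exists_notMem L).1 hu
  obtain ⟨m, hm, hmin⟩ : ∃ m, m ∉ L ∧ ∀ k < m, k ∈ L :=
    ⟨Nat.find hex, Nat.find_spec hex, fun k hk => not_not.1 (Nat.find_min hex hk)⟩
  obtain ⟨hopp, hfin⟩ := evenOddClass_of_notMem hL hm
  have hmissing : ∀ᶠ n in atTop, firstMissing (pref T n) = m := by
    have hall : ∀ᶠ n in atTop, ∀ k ∈ Set.Iio m, some k ∈ pref T n :=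
      (eventually_all_finite (Set.finite_Iio m)).2 fun k hk => hT.eventually_mem (hmin k hk)
    filter_upwards [hall, eventually_gt_atTop m] with n hn hlt
    exact firstMissing_eq (by rwa [length_pref]) (fun h => hm (hT.mem_of_mem_pref h)) hn
  obtain ⟨l, hl⟩ := eventually_seenOfParity_eq hT hfin
  refine ⟨idx (m % 2, l), ?_, ?_⟩
  · rw [hidx]
    ext x
    by_cases hx : x % 2 = m % 2
    · have hiff : some x ∈ l ↔ x ∈ L := by
        constructor
        · intro h
          obtain ⟨n, hn⟩ := hl.exists
          rw [← hn] at h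
          exact hT.mem_of_mem_pref (mem_seenOfParity.1 h).1
        · intro h
          obtain ⟨n, hn, hmem⟩ := (hl.and (hT.eventually_mem h)).exists
          rw [← hn]
          exact mem_seenOfParity.2 ⟨hmem, hx⟩
      simp [ParityConj, hx, hiff]
    · exact iff_of_true (Or.inl hx) (hopp x hx)
  · rw [← map_add_atTop_eq_nat 1, eventually_map]
    filter_upwards [hmissing, (tendsto_add_atTop_nat 1).eventually hmissing,
      (tendsto_add_atTop_nat 1).eventually hl] with n h₁ h₂ h₃
    rw [partLearner_pref_succ, if_neg (by rw [h₁, h₂]; simp), parityData, h₂, h₃]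

end PartLearner

theorem exists_cons_part_learner :
    ∃ M : List (Option ℕ) → ℕ, Computable M ∧ ConsLearner M ∧ PartLearns M evenOddClass := by
  obtain ⟨idx, hcomp, hidx⟩ := exists_computable_index_s15 primrecRel_parityConj
  -- `ℕ` is also the set of all numbers of parity other than `2`.
  have heN : Wset (idx (2, [])) = Set.univ := by
    rw [hidx]
    ext x
    simp only [ParityConj, Set.mem_ofPred_eq, Set.mem_univ, iff_true]
    omega
  refine ⟨partLearner (idx (2, [])) idx, computable_partLearner _ hcomp,
    partLearner_cons heN hidx, fun L hL T hT => ?_⟩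
  by_cases hu : L = Set.univ
  · subst hu
    exact ⟨_, infinite_partLearner_eq_of_univ hT, heN,
      fun d hd => eq_of_infinite_partLearner_of_univ heN hidx hT hd⟩
  · obtain ⟨e, he, hev⟩ := eventually_partLearner_eq_of_ne_univ hidx hL hu hT
    refine ⟨e, Nat.frequently_atTop_iff_infinite.1 hev.frequently, he, fun d hd => ?_⟩
    obtain ⟨n, hn, hn'⟩ := ((Nat.frequently_atTop_iff_infinite.2 hd).and_eventually hev).exists
    exact hn.symm.trans hn'

/-! ### Partial learning excludes weakly approximate learning -/

/-- A partial learner can be led from any `σ` to conjecture exactly the numbers of a given parity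
together with those occurring in `σ`. -/
theorem PartLearns.exists_append_Wset_eq {M : List (Option ℕ) → ℕ}
    (hM : PartLearns M evenOddClass) (σ : List (Option ℕ)) {p : ℕ} (hp : p < 2) :
    ∃ ρ, Wset (M (σ ++ ρ)) = {x | x % 2 = p ∨ some x ∈ σ} := by
  have hfin : {x | some x ∈ σ}.Finite :=
    (List.finite_toSet σ).preimage (Option.some_injective ℕ).injOn
  set T : ℕ → Option ℕ := fun n => if h : n < σ.length then σ[n] else some (2 * (n - σ.length) + p)
    with hTdef
  have hT : IsText T {x | x % 2 = p ∨ some x ∈ σ} := by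
    ext x
    simp only [Set.mem_ofPred_eq]
    constructor
    · rintro ⟨n, hn⟩
      simp only [hTdef] at hn
      split_ifs at hn with h
      · exact Or.inr (hn ▸ List.getElem_mem h)
      · left
        have := Option.some.inj hn
        omega
    · rintro (h | h)
      · refine ⟨σ.length + x / 2, ?_⟩
        simp only [hTdef]
        rw [dif_neg (by omega)]
        congr 1
        omega
      · obtain ⟨n, hn, hx⟩ := List.getElem_of_mem h
        exact ⟨n, by simp [hTdef, hn, hx]⟩
  obtain ⟨e, hinf, he, -⟩ := hM _ (parity_union_mem_evenOddClass hp hfin) T hT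
  obtain ⟨n, hn, hlen⟩ := ((Nat.frequently_atTop_iff_infinite.2 hinf).and_eventually
    (eventually_ge_atTop σ.length)).exists
  have hpre : σ <+: pref T n := by
    rw [List.prefix_iff_getElem]
    refine ⟨by rwa [length_pref], fun i hi => ?_⟩
    simp [pref, hTdef, hi]
  obtain ⟨ρ, hρ⟩ := hpre
  exact ⟨ρ, by rw [hρ, hn, he]; rfl⟩

/-- Every sequence of finite sequences in which each properly extends its predecessor
converges to an infinite sequence. -/
theorem exists_pref_eq_of_prefix {s : ℕ → List (Option ℕ)} (hs : ∀ k, s k <+: s (k + 1))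
    (hlen : ∀ k, (s k).length < (s (k + 1)).length) :
    ∃ T : ℕ → Option ℕ, ∀ k τ, τ <+: s k → pref T τ.length = τ := by
  have hmono : ∀ j k, j ≤ k → s j <+: s k := by
    intro j k hjk
    induction k, hjk using Nat.le_induction with
    | base => exact List.prefix_rfl
    | succ k _ ih => exact ih.trans (hs k)
  have hgrow : StrictMono fun k => (s k).length := strictMono_nat_of_lt_succ hlen
  refine ⟨fun n => (s (n + 1)).getD n none, fun k τ hτ => ?_⟩
  refine List.ext_getElem (length_pref _ _) fun i _ hi => ?_
  have hi' : i < (s (i + 1)).length := hgrow.le_apply (x := i + 1)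
  have hget : (s (i + 1))[i] = τ[i] := by
    rcases le_total k (i + 1) with h | h
    · exact ((hτ.trans (hmono _ _ h)).getElem hi).symm
    · rw [(hmono _ _ h).getElem hi', hτ.getElem hi]
  simp [pref, hi', hget]

theorem PartLearns.not_weakApproxLearns {M : List (Option ℕ) → ℕ}
    (hM : PartLearns M evenOddClass) : ¬ WeakApproxLearns M evenOddClass := by
  intro hweak
  choose ρ hρ using fun (σ : List (Option ℕ)) (k : ℕ) =>
    hM.exists_append_Wset_eq σ (Nat.mod_lt k two_pos)
  let s : ℕ → List (Option ℕ) := fun k => Nat.rec [] (fun j σ => σ ++ ρ σ j ++ [some j]) k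
  have hs : ∀ k, s (k + 1) = s k ++ ρ (s k) k ++ [some k] := fun k => rfl
  obtain ⟨T, hT⟩ := exists_pref_eq_of_prefix (s := s)
    (fun k => by rw [hs, List.append_assoc]; exact List.prefix_append _ _)
    (fun k => by rw [hs]; simp only [List.length_append, List.length_singleton]; omega)
  have hstep : ∀ k, pref T (s k ++ ρ (s k) k).length = s k ++ ρ (s k) k := fun k =>
    hT (k + 1) _ (by rw [hs]; exact List.prefix_append _ _)
  have hle : ∀ k, k ≤ (s k).length := by
    intro k
    induction k with
    | zero => exact Nat.zero_le _
    | succ k ih =>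
      rw [hs]
      simp only [List.length_append, List.length_singleton]
      omega
  have htext : IsText T Set.univ := by
    refine Set.eq_univ_of_forall fun x => ?_
    have hmem : some x ∈ pref T (s (x + 1)).length := by
      rw [hT (x + 1) _ List.prefix_rfl, hs]
      simp
    obtain ⟨m, -, hm⟩ := mem_pref.1 hmem
    exact ⟨m, hm⟩
  obtain ⟨W, hinf, hW⟩ := hweak _ (Or.inl rfl) T htext
  obtain ⟨N, hN⟩ := eventually_atTop.1 (hW W (by simp))
  have hsub : ∀ k ≥ N, ∀ x ∈ W, x % 2 = k % 2 ∨ some x ∈ s k := by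
    intro k hk x hx
    have hlen : N ≤ (s k ++ ρ (s k) k).length := by
      have := hle k
      simp only [List.length_append]
      omega
    have h := hN _ hlen
    rw [hstep, hρ, Set.univ_inter] at h
    exact (h.symm ▸ hx : x ∈ {x | x % 2 = k % 2 ∨ some x ∈ s k} ∩ W).1
  refine hinf (((List.finite_toSet (s N ++ s (N + 1))).preimage
    (Option.some_injective ℕ).injOn).subset fun x hx => ?_)
  have h₁ := hsub N le_rfl x hx
  have h₂ := hsub (N + 1) (by omega) x hx
  simp only [Set.mem_preimage, Set.mem_ofPred_eq, List.mem_append]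
  by_cases h : x % 2 = N % 2
  · exact Or.inr (h₂.resolve_left (by omega))
  · exact Or.inl (h₁.resolve_left h)

/-- `evenOddClass` is (a) ConsWeakApprox learnable and (b) ConsPart learnable,
but (c) not WeakApproxPart learnable. -/
theorem stmt15 :
    (∃ M : List (Option ℕ) → ℕ, Computable M ∧ ConsLearner M ∧
       WeakApproxLearns M evenOddClass) ∧
    (∃ M : List (Option ℕ) → ℕ, Computable M ∧ ConsLearner M ∧
       PartLearns M evenOddClass) ∧
    (¬ ∃ M : List (Option ℕ) → ℕ, Computable M ∧
       WeakApproxLearns M evenOddClass ∧ PartLearns M evenOddClass) := by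
  exact ⟨exists_cons_weakApprox_learner, exists_cons_part_learner,
    fun ⟨_, _, hweak, hpart⟩ => hpart.not_weakApproxLearns hweak⟩
end
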